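/- arXiv:2512.24807 — 2 statements merged into one kernel-verified Lean document; each statement's English description precedes it below -/
import Mathlib

section
/- Assume β₁ < α and that ∂D satisfies the Aikawa condition with exponent q' for some q' ∈ (β₁, d]. Then for every Lipschitz function u : closure(D) → ℝ with compact support, ∫_{D×D} (u(x) − u(y))² J(x,y) dx dy < ∞. -/
open MeasureTheory Metric Set ENNReal Filter

noncomputable def deltaD {d : ℕ} (D : Set (EuclideanSpace ℝ (Fin d)))
    (x : EuclideanSpace ℝ (Fin d)) : ℝ :=
  Metric.infDist x (frontier D)

def Aikawa {d : ℕ} (D : Set (EuclideanSpace ℝ (Fin d))) (q : ℝ) : Prop :=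
  ∃ C₀ : ℝ, 1 ≤ C₀ ∧ ∀ x ∈ frontier D, ∀ r s : ℝ, 0 < s → s ≤ r →
    ENNReal.ofReal r < EMetric.diam (frontier D) →
    MeasureTheory.volume {y : EuclideanSpace ℝ (Fin d) |
        y ∈ Metric.ball x r ∧ Metric.infDist y (frontier D) < s} ≤
      ENNReal.ofReal (C₀ * (s / r) ^ q) * MeasureTheory.volume (Metric.ball x r)

noncomputable def truncMin (A : ℝ≥0∞) (r : ℝ) : ℝ := (min (ENNReal.ofReal r) A).toReal

theorem volume_ball_eq_ofReal {d : ℕ} (x : EuclideanSpace ℝ (Fin d)) {r : ℝ} (hr : 0 < r) :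
    volume (ball x r) =
      ENNReal.ofReal (r ^ d * (volume (ball (0 : EuclideanSpace ℝ (Fin d)) 1)).toReal) := by
  rw [Measure.addHaar_ball_of_pos volume x hr, finrank_euclideanSpace_fin,
    ENNReal.ofReal_mul (by positivity), ENNReal.ofReal_toReal measure_ball_lt_top.ne]

theorem div_rpow_mul_pow_le {d : ℕ} {q s a b κ : ℝ} (hq0 : 0 ≤ q) (hqd : q ≤ d) (hs : 0 < s)
    (ha : 0 < a) (hb : 0 < b) (hκ : 1 ≤ κ) (hab : a ≤ κ * b) :
    (s / a) ^ q * a ^ d ≤ κ ^ d * ((s / b) ^ q * b ^ d) := by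
  have key : ∀ c : ℝ, 0 < c → (s / c) ^ q * c ^ d = s ^ q * c ^ ((d : ℝ) - q) := by
    intro c hc
    rw [Real.div_rpow hs.le hc.le, Real.rpow_sub hc, Real.rpow_natCast]
    ring
  have hκ0 : 0 < κ := by linarith
  rw [key a ha, key b hb]
  calc s ^ q * a ^ ((d : ℝ) - q) ≤ s ^ q * (κ * b) ^ ((d : ℝ) - q) := by
        gcongr
    _ = κ ^ ((d : ℝ) - q) * (s ^ q * b ^ ((d : ℝ) - q)) := by
        rw [Real.mul_rpow hκ0.le hb.le]
        ring
    _ ≤ κ ^ d * (s ^ q * b ^ ((d : ℝ) - q)) := by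
        gcongr
        rw [← Real.rpow_natCast]
        exact Real.rpow_le_rpow_of_exponent_le hκ (by linarith)

/-- The Aikawa condition, extended to all centres and all radii. -/
theorem Aikawa.exists_volume_le {d : ℕ} {D : Set (EuclideanSpace ℝ (Fin d))} {q : ℝ}
    (h : Aikawa D q) (hfr : (frontier D).Nonempty) (hq0 : 0 ≤ q) (hqd : q ≤ d) :
    ∃ C : ℝ, 0 ≤ C ∧ ∀ (x : EuclideanSpace ℝ (Fin d)) (r s : ℝ), 0 < s → s ≤ r →
      volume {y | y ∈ ball x r ∧ deltaD D y < s} ≤ ENNReal.ofReal (C * ((s / r) ^ q * r ^ d)) := by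
  obtain ⟨C₀, hC₀, hA⟩ := h
  set v := (volume (ball (0 : EuclideanSpace ℝ (Fin d)) 1)).toReal with hv
  have hv0 : 0 ≤ v := ENNReal.toReal_nonneg
  have hbd : ∀ z ∈ frontier D, ∀ r s b κ : ℝ, 0 < s → s ≤ r → 0 < b → 1 ≤ κ → r ≤ κ * b →
      ENNReal.ofReal r < ediam (frontier D) →
      volume {y | y ∈ ball z r ∧ deltaD D y < s} ≤
        ENNReal.ofReal (C₀ * κ ^ d * v * ((s / b) ^ q * b ^ d)) := by
    intro z hz r s b κ hs hsr hb hκ hrb hr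
    have hr0 : 0 < r := hs.trans_le hsr
    refine (hA z hz r s hs hsr hr).trans ?_
    rw [volume_ball_eq_ofReal z hr0, ← ENNReal.ofReal_mul (by positivity)]
    refine ENNReal.ofReal_le_ofReal ?_
    have := div_rpow_mul_pow_le hq0 hqd hs hr0 hb hκ hrb
    calc C₀ * (s / r) ^ q * (r ^ d * v) = C₀ * v * ((s / r) ^ q * r ^ d) := by ring
      _ ≤ C₀ * v * (κ ^ d * ((s / b) ^ q * b ^ d)) := by gcongr
      _ = _ := by ring
  obtain ⟨z₀, hz₀⟩ := hfr
  set R := (ediam (frontier D)).toReal with hR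
  have hcov : ∃ t : Finset (EuclideanSpace ℝ (Fin d)), ediam (frontier D) ≠ ⊤ → 0 < R →
      (∀ z ∈ t, z ∈ frontier D) ∧ ∀ w ∈ frontier D, ∃ z ∈ t, dist w z < R / 4 := by
    by_cases hc : ediam (frontier D) ≠ ⊤ ∧ 0 < R
    · have hcomp : IsCompact (frontier D) :=
        isCompact_of_isClosed_isBounded isClosed_frontier (isBounded_iff_ediam_ne_top.2 hc.1)
      obtain ⟨t, ht, hfin, hsub⟩ := hcomp.finite_cover_balls (e := R / 4) (by linarith [hc.2])
      refine ⟨hfin.toFinset, fun _ _ => ⟨fun z hz => ht (hfin.mem_toFinset.1 hz), fun w hw => ?_⟩⟩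
      obtain ⟨z, hz, hwz⟩ := mem_iUnion₂.1 (hsub hw)
      exact ⟨z, hfin.mem_toFinset.2 hz, hwz⟩
    · exact ⟨∅, fun h1 h2 => absurd ⟨h1, h2⟩ hc⟩
  obtain ⟨t, ht⟩ := hcov
  refine ⟨C₀ * 3 ^ d * v + 6 ^ d * v * 3 ^ d + t.card * (C₀ * 3 ^ d * v), by positivity, ?_⟩
  intro x r s hs hsr
  have hr0 : 0 < r := hs.trans_le hsr
  set P := (s / r) ^ q * r ^ d with hP
  have hP0 : 0 ≤ P := by positivity
  have near : ∀ y, deltaD D y < s → ∃ w ∈ frontier D, dist y w < s := fun y hy =>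
    (infDist_lt_iff ⟨z₀, hz₀⟩).1 hy
  by_cases h3 : ENNReal.ofReal (3 * r) < ediam (frontier D)
  · rcases Set.eq_empty_or_nonempty {y | y ∈ ball x r ∧ deltaD D y < s} with he | ⟨y₀, hy₀, hys⟩
    · rw [he]; simp
    obtain ⟨w, hw, hyw⟩ := near y₀ hys
    calc volume {y | y ∈ ball x r ∧ deltaD D y < s}
        ≤ volume {y | y ∈ ball w (3 * r) ∧ deltaD D y < s} := by
          refine measure_mono fun y hy => ⟨?_, hy.2⟩
          have h1 : dist y x < r := hy.1
          have h2 : dist y₀ x < r := hy₀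
          have h4 := dist_triangle y x w
          have h5 := dist_triangle x y₀ w
          rw [dist_comm x y₀] at h5
          rw [mem_ball]; linarith
      _ ≤ ENNReal.ofReal (C₀ * 3 ^ d * v * P) :=
          hbd w hw _ s r 3 hs (by linarith) hr0 (by norm_num) le_rfl h3
      _ ≤ _ := by
          refine ENNReal.ofReal_le_ofReal ?_
          gcongr
          have : 0 ≤ 6 ^ d * v * 3 ^ d := by positivity
          have : 0 ≤ t.card * (C₀ * 3 ^ d * v) := by positivity
          linarith
  · push Not at h3
    have hfin : ediam (frontier D) ≠ ⊤ := ne_top_of_le_ne_top ENNReal.ofReal_ne_top h3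
    have hR3 : R ≤ 3 * r := ENNReal.toReal_le_of_le_ofReal (by positivity) h3
    by_cases h4 : R ≤ 4 * s
    · calc volume {y | y ∈ ball x r ∧ deltaD D y < s}
          ≤ volume (ball z₀ (6 * s)) := by
            refine measure_mono fun y hy => ?_
            obtain ⟨w, hw, hyw⟩ := near y hy.2
            have h5 : dist w z₀ ≤ R := by
              rw [dist_edist]
              exact ENNReal.toReal_mono hfin (Metric.edist_le_ediam_of_mem hw hz₀)
            have := dist_triangle y w z₀
            rw [mem_ball]; linarith
        _ = ENNReal.ofReal ((6 * s) ^ d * v) := volume_ball_eq_ofReal _ (by positivity)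
        _ ≤ ENNReal.ofReal (6 ^ d * v * 3 ^ d * P) := by
            refine ENNReal.ofReal_le_ofReal ?_
            have := div_rpow_mul_pow_le hq0 hqd hs hs hr0 (κ := 3) (by norm_num) (by linarith)
            rw [div_self hs.ne', Real.one_rpow, one_mul] at this
            calc (6 * s) ^ d * v = 6 ^ d * v * s ^ d := by rw [mul_pow]; ring
              _ ≤ 6 ^ d * v * (3 ^ d * P) := by gcongr
              _ = _ := by ring
        _ ≤ _ := by
            refine ENNReal.ofReal_le_ofReal ?_
            gcongr
            have : 0 ≤ C₀ * 3 ^ d * v := by positivity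
            have : 0 ≤ t.card * (C₀ * 3 ^ d * v) := by positivity
            linarith
    · push Not at h4
      have hR0 : 0 < R := by linarith
      obtain ⟨ht1, ht2⟩ := ht hfin hR0
      have hRlt : ENNReal.ofReal (R / 2) < ediam (frontier D) := by
        rw [← ENNReal.ofReal_toReal hfin, ← hR]
        exact (ENNReal.ofReal_lt_ofReal_iff hR0).2 (by linarith)
      calc volume {y | y ∈ ball x r ∧ deltaD D y < s}
          ≤ volume (⋃ z ∈ t, {y | y ∈ ball z (R / 2) ∧ deltaD D y < s}) := by
            refine measure_mono fun y hy => ?_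
            obtain ⟨w, hw, hyw⟩ := near y hy.2
            obtain ⟨z, hz, hwz⟩ := ht2 w hw
            have := dist_triangle y w z
            exact mem_iUnion₂.2 ⟨z, hz, by rw [mem_ball]; linarith, hy.2⟩
        _ ≤ ∑ z ∈ t, volume {y | y ∈ ball z (R / 2) ∧ deltaD D y < s} :=
            measure_biUnion_finset_le _ _
        _ ≤ ∑ z ∈ t, ENNReal.ofReal (C₀ * 3 ^ d * v * P) :=
            Finset.sum_le_sum fun z hz =>
              hbd z (ht1 z hz) _ s r 3 hs (by linarith) hr0 (by norm_num) (by linarith) hRlt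
        _ = ENNReal.ofReal (t.card * (C₀ * 3 ^ d * v) * P) := by
            rw [Finset.sum_const, nsmul_eq_mul, mul_assoc (t.card : ℝ),
              ENNReal.ofReal_mul (Nat.cast_nonneg _), ENNReal.ofReal_natCast]
        _ ≤ _ := by
            refine ENNReal.ofReal_le_ofReal ?_
            gcongr
            have : 0 ≤ C₀ * 3 ^ d * v := by positivity
            have : 0 ≤ 6 ^ d * v * 3 ^ d := by positivity
            linarith

theorem measurable_deltaD {d : ℕ} (D : Set (EuclideanSpace ℝ (Fin d))) : Measurable (deltaD D) :=
  (continuous_infDist_pt _).measurable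

theorem deltaD_nonneg {d : ℕ} (D : Set (EuclideanSpace ℝ (Fin d)))
    (x : EuclideanSpace ℝ (Fin d)) : 0 ≤ deltaD D x :=
  infDist_nonneg

theorem deltaD_pos {d : ℕ} {D : Set (EuclideanSpace ℝ (Fin d))} (hD : IsOpen D)
    (hfr : (frontier D).Nonempty) {x : EuclideanSpace ℝ (Fin d)} (hx : x ∈ D) : 0 < deltaD D x := by
  refine (isClosed_frontier.notMem_iff_infDist_pos hfr).1 fun h => ?_
  have : x ∈ D ∩ frontier D := ⟨hx, h⟩
  rwa [hD.inter_frontier_eq] at this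

/-- Scale-invariant integrability of negative powers of the distance to the boundary. -/
theorem Aikawa.exists_lintegral_le {d : ℕ} {D : Set (EuclideanSpace ℝ (Fin d))} {q β : ℝ}
    (h : Aikawa D q) (hfr : (frontier D).Nonempty) (hβ0 : 0 ≤ β) (hβq : β < q) (hqd : q ≤ d) :
    ∃ M : ℝ≥0∞, M ≠ ⊤ ∧ ∀ (x : EuclideanSpace ℝ (Fin d)) (r : ℝ), 0 < r →
      ∫⁻ y in ball x r, ENNReal.ofReal ((1 + r / deltaD D y) ^ β) ≤ M * ENNReal.ofReal (r ^ d) := by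
  obtain ⟨C, hC0, hC⟩ := h.exists_volume_le hfr (hβ0.trans hβq.le) hqd
  set v := (volume (ball (0 : EuclideanSpace ℝ (Fin d)) 1)).toReal with hv
  have hv0 : 0 ≤ v := ENNReal.toReal_nonneg
  set ρ : ℝ := 2 ^ (β - q) with hρ
  have hρ0 : 0 < ρ := by positivity
  have hρ1 : ρ < 1 := Real.rpow_lt_one_of_one_lt_of_neg (by norm_num) (by linarith)
  have hsum : Summable fun n : ℕ => 4 ^ β * C * 2 ^ d * ρ ^ n :=
    (summable_geometric_of_lt_one hρ0.le hρ1).mul_left _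
  refine ⟨ENNReal.ofReal (2 ^ β * v) + ∑' n : ℕ, ENNReal.ofReal (4 ^ β * C * 2 ^ d * ρ ^ n),
    ENNReal.add_ne_top.2 ⟨ENNReal.ofReal_ne_top, hsum.tsum_ofReal_ne_top⟩, ?_⟩
  intro x r hr
  let S : ℕ → Set (EuclideanSpace ℝ (Fin d)) := fun n =>
    {y | y ∈ ball x (2 * r) ∧ deltaD D y < 2 * r / 2 ^ n}
  have hS : ∀ n, MeasurableSet (S n) := fun n =>
    measurableSet_ball.inter (measurableSet_lt (measurable_deltaD D) measurable_const)
  have hpt : ∀ y ∈ ball x r, ENNReal.ofReal ((1 + r / deltaD D y) ^ β) ≤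
      ENNReal.ofReal (2 ^ β) +
        ∑' n : ℕ, (S n).indicator (fun _ => ENNReal.ofReal ((4 * 2 ^ n) ^ β)) y := by
    intro y hy
    rcases (deltaD_nonneg D y).eq_or_lt with h0 | hpos
    · rw [← h0]
      refine le_add_right (ENNReal.ofReal_le_ofReal ?_)
      gcongr
      norm_num
    rcases le_or_gt r (deltaD D y) with hle | hlt
    · refine le_add_right (ENNReal.ofReal_le_ofReal ?_)
      have : r / deltaD D y ≤ 1 := (div_le_one hpos).2 hle
      gcongr
      linarith
    · obtain ⟨n, hn1, hn2⟩ := exists_nat_pow_near (x := r / deltaD D y) (y := 2)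
        ((one_le_div hpos).2 hlt.le) (by norm_num)
      have hyS : y ∈ S n := by
        refine ⟨ball_subset_ball (by linarith) hy, ?_⟩
        rw [le_div_iff₀ hpos] at hn1
        rw [lt_div_iff₀ (by positivity)]
        nlinarith
      refine le_add_left (le_trans ?_ (ENNReal.le_tsum n))
      rw [indicator_of_mem hyS]
      refine ENNReal.ofReal_le_ofReal (Real.rpow_le_rpow (by positivity) ?_ hβ0)
      have : (1 : ℝ) ≤ 2 ^ n := one_le_pow₀ (by norm_num)
      rw [pow_succ] at hn2
      linarith
  have hterm : ∀ n : ℕ, ENNReal.ofReal ((4 * 2 ^ n) ^ β) * volume (S n) ≤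
      ENNReal.ofReal (4 ^ β * C * 2 ^ d * ρ ^ n) * ENNReal.ofReal (r ^ d) := by
    intro n
    have h2n : (1 : ℝ) ≤ 2 ^ n := one_le_pow₀ (by norm_num)
    have := hC x (2 * r) (2 * r / 2 ^ n) (by positivity) (div_le_self (by positivity) h2n)
    calc _ ≤ ENNReal.ofReal ((4 * 2 ^ n) ^ β) *
          ENNReal.ofReal (C * ((2 * r / 2 ^ n / (2 * r)) ^ q * (2 * r) ^ d)) := by gcongr
      _ = _ := by
        rw [← ENNReal.ofReal_mul (by positivity), ← ENNReal.ofReal_mul (by positivity)]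
        congr 1
        have e1 : 2 * r / 2 ^ n / (2 * r) = ((2 : ℝ) ^ n)⁻¹ := by field_simp
        have e2 : ρ ^ n = ((2 : ℝ) ^ n) ^ β * (((2 : ℝ) ^ n) ^ q)⁻¹ := by
          rw [hρ, ← Real.rpow_natCast, ← Real.rpow_mul (by norm_num), mul_comm, Real.rpow_mul
            (by norm_num), Real.rpow_natCast, Real.rpow_sub (by positivity), div_eq_mul_inv]
        rw [e1, e2, Real.mul_rpow (by norm_num) (by positivity), Real.inv_rpow (by positivity),
          mul_pow]
        ring
  calc ∫⁻ y in ball x r, ENNReal.ofReal ((1 + r / deltaD D y) ^ β)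
      ≤ ∫⁻ y in ball x r, (ENNReal.ofReal (2 ^ β) +
          ∑' n : ℕ, (S n).indicator (fun _ => ENNReal.ofReal ((4 * 2 ^ n) ^ β)) y) :=
        setLIntegral_mono' measurableSet_ball hpt
    _ = ENNReal.ofReal (2 ^ β) * volume (ball x r) +
          ∑' n : ℕ, ENNReal.ofReal ((4 * 2 ^ n) ^ β) * (volume.restrict (ball x r)) (S n) := by
        rw [lintegral_add_left measurable_const, setLIntegral_const,
          lintegral_tsum fun n => (measurable_const.indicator (hS n)).aemeasurable]
        congr 2
        ext n
        rw [lintegral_indicator_const (hS n)]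
    _ ≤ ENNReal.ofReal (2 ^ β) * ENNReal.ofReal (r ^ d * v) +
          ∑' n : ℕ, ENNReal.ofReal (4 ^ β * C * 2 ^ d * ρ ^ n) * ENNReal.ofReal (r ^ d) := by
        rw [volume_ball_eq_ofReal x hr]
        refine add_le_add_right (ENNReal.tsum_le_tsum fun n => le_trans ?_ (hterm n)) _
        gcongr
        exact Measure.restrict_le_self
    _ = _ := by
        rw [ENNReal.tsum_mul_right, add_mul, ← ENNReal.ofReal_mul (by positivity),
          ← ENNReal.ofReal_mul (by positivity)]
        congr 2
        ring

theorem truncMin_div_le {A : ℝ≥0∞} (hA : 0 < A) {r t : ℝ} (hr : 0 ≤ r) (ht : 0 < t) :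
    0 ≤ truncMin A r / truncMin A t ∧ truncMin A r / truncMin A t ≤ 1 + r / t := by
  refine ⟨div_nonneg ENNReal.toReal_nonneg ENNReal.toReal_nonneg, ?_⟩
  have hrt : 0 ≤ r / t := by positivity
  rcases eq_or_ne A ⊤ with rfl | hfin
  · simp only [truncMin, min_top_right, ENNReal.toReal_ofReal hr, ENNReal.toReal_ofReal ht.le]
    linarith
  · have ha : 0 < A.toReal := ENNReal.toReal_pos hA.ne' hfin
    have key : ∀ s : ℝ, 0 ≤ s → truncMin A s = min s A.toReal := fun s hs => by
      rw [truncMin, ENNReal.toReal_min ENNReal.ofReal_ne_top hfin, ENNReal.toReal_ofReal hs]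
    rw [key r hr, key t ht.le, div_le_iff₀ (lt_min ht ha)]
    rcases le_total t A.toReal with h | h
    · rw [min_eq_left h, add_mul, div_mul_cancel₀ _ ht.ne']
      linarith [min_le_left r A.toReal]
    · rw [min_eq_right h]
      nlinarith [min_le_right r A.toReal]

theorem scaling_le_rpow_mul_rpow {Φ : ℝ → ℝ} {β C : ℝ} (hΦmono : MonotoneOn Φ (Ici 0))
    (hΦscale : ∀ s r : ℝ, 0 < s → s ≤ r → Φ r ≤ C * (r / s) ^ β * Φ s)
    {R X Y s t : ℝ} (hX : 0 ≤ R / X) (hY : 0 ≤ R / Y) (hXs : R / X ≤ s) (hYt : R / Y ≤ t)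
    (hs : 1 ≤ s) (ht : 1 ≤ t) :
    Φ (R ^ 2 / (X * Y)) ≤ C * Φ 1 * (s ^ β * t ^ β) := by
  have e : R ^ 2 / (X * Y) = R / X * (R / Y) := by rw [div_mul_div_comm, sq]
  have hst : 1 ≤ s * t := one_le_mul_of_one_le_of_one_le hs ht
  have h1 : Φ (R ^ 2 / (X * Y)) ≤ Φ (s * t) := by
    rw [e]
    exact hΦmono (mul_nonneg hX hY) (by rw [mem_Ici]; linarith) (by gcongr)
  refine h1.trans ((hΦscale 1 (s * t) one_pos hst).trans_eq ?_)
  rw [div_one, Real.mul_rpow (by linarith) (by linarith)]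
  ring

/-- The kernel dominating the jump density against truncated squared increments. -/
noncomputable def dominatingKernel {d : ℕ} (D : Set (EuclideanSpace ℝ (Fin d))) (α β : ℝ)
    (x y : EuclideanSpace ℝ (Fin d)) : ℝ :=
  min 1 (dist x y ^ 2) * dist x y ^ (-((d : ℝ) + α)) *
    ((1 + dist x y / deltaD D x) ^ β * (1 + dist x y / deltaD D y) ^ β)

theorem dominatingKernel_comm {d : ℕ} (D : Set (EuclideanSpace ℝ (Fin d))) (α β : ℝ)
    (x y : EuclideanSpace ℝ (Fin d)) :
    dominatingKernel D α β x y = dominatingKernel D α β y x := by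
  simp only [dominatingKernel, dist_comm x y]
  ring

theorem measurable_dominatingKernel {d : ℕ} (D : Set (EuclideanSpace ℝ (Fin d))) (α β : ℝ) :
    Measurable fun p : EuclideanSpace ℝ (Fin d) × EuclideanSpace ℝ (Fin d) =>
      dominatingKernel D α β p.1 p.2 := by
  have h1 : Measurable fun p : EuclideanSpace ℝ (Fin d) × EuclideanSpace ℝ (Fin d) =>
    deltaD D p.1 := (measurable_deltaD D).comp measurable_fst
  have h2 : Measurable fun p : EuclideanSpace ℝ (Fin d) × EuclideanSpace ℝ (Fin d) =>
    deltaD D p.2 := (measurable_deltaD D).comp measurable_snd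
  have h3 : Measurable fun p : EuclideanSpace ℝ (Fin d) × EuclideanSpace ℝ (Fin d) =>
    dist p.1 p.2 := measurable_dist
  exact ((measurable_const.min (h3.pow_const 2)).mul (h3.pow_const _)).mul
    (((measurable_const.add (h3.div h1)).pow_const β).mul
      ((measurable_const.add (h3.div h2)).pow_const β))

/-- The contribution of the dyadic shell of inner radius `t`. -/
noncomputable def shellWeight (d : ℕ) (α β t : ℝ) : ℝ :=
  min 1 ((2 * t) ^ 2) * t ^ (-((d : ℝ) + α)) * max 1 (2 * t) ^ β

theorem shellWeight_nonneg (d : ℕ) (α β : ℝ) {t : ℝ} (ht : 0 < t) : 0 ≤ shellWeight d α β t := by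
  unfold shellWeight
  positivity

theorem summable_shellWeight {d : ℕ} {α β : ℝ} (hα2 : α < 2) (hβ0 : 0 ≤ β) (hβα : β < α) :
    Summable fun k : ℤ => shellWeight d α β (2 ^ k) * (2 * 2 ^ k) ^ d := by
  have hcancel : ∀ t : ℝ, 0 < t → t ^ (-((d : ℝ) + α)) * t ^ d = t ^ (-α) := fun t ht => by
    rw [← Real.rpow_natCast, ← Real.rpow_add ht]
    congr 1
    ring
  have hlarge : ∀ t : ℝ, 1 ≤ t →
      shellWeight d α β t * (2 * t) ^ d ≤ 2 ^ β * 2 ^ d * t ^ (β - α) := by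
    intro t ht
    have ht0 : 0 < t := by linarith
    rw [shellWeight, max_eq_right (by linarith : (1 : ℝ) ≤ 2 * t)]
    calc min 1 ((2 * t) ^ 2) * t ^ (-((d : ℝ) + α)) * (2 * t) ^ β * (2 * t) ^ d
        ≤ 1 * t ^ (-((d : ℝ) + α)) * (2 * t) ^ β * (2 * t) ^ d := by
          gcongr
          exact min_le_left _ _
      _ = 2 ^ β * 2 ^ d * (t ^ β * (t ^ (-((d : ℝ) + α)) * t ^ d)) := by
          rw [Real.mul_rpow (by norm_num) ht0.le, mul_pow]
          ring
      _ = _ := by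
          rw [hcancel t ht0, ← Real.rpow_add ht0, sub_eq_add_neg]
  have hsmall : ∀ t : ℝ, 0 < t → t ≤ 1 →
      shellWeight d α β t * (2 * t) ^ d ≤ 4 * 2 ^ β * 2 ^ d * t ^ (2 - α) := by
    intro t ht0 ht
    rw [shellWeight]
    calc min 1 ((2 * t) ^ 2) * t ^ (-((d : ℝ) + α)) * max 1 (2 * t) ^ β * (2 * t) ^ d
        ≤ (2 * t) ^ 2 * t ^ (-((d : ℝ) + α)) * 2 ^ β * (2 * t) ^ d := by
          gcongr
          · exact min_le_right _ _
          · exact max_le (by norm_num) (by linarith)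
      _ = 4 * 2 ^ β * 2 ^ d * (t ^ 2 * (t ^ (-((d : ℝ) + α)) * t ^ d)) := by
          rw [mul_pow, mul_pow]
          ring
      _ = _ := by
          rw [hcancel t ht0, ← Real.rpow_two, ← Real.rpow_add ht0, sub_eq_add_neg]
  have hnn : ∀ k : ℤ, 0 ≤ shellWeight d α β (2 ^ k) * (2 * 2 ^ k) ^ d := fun k =>
    mul_nonneg (shellWeight_nonneg d α β (by positivity)) (by positivity)
  have hgeom : ∀ e : ℝ, e < 0 → Summable fun n : ℕ => ((2 : ℝ) ^ e) ^ n := fun e he =>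
    summable_geometric_of_lt_one (by positivity)
      (Real.rpow_lt_one_of_one_lt_of_neg (by norm_num) he)
  refine Summable.of_nat_of_neg ?_ ?_
  · refine ((hgeom (β - α) (by linarith)).mul_left (2 ^ β * 2 ^ d)).of_nonneg_of_le
      (fun n => hnn n) fun n => ?_
    have h := hlarge (2 ^ (n : ℤ)) (by rw [zpow_natCast]; exact one_le_pow₀ (by norm_num))
    refine h.trans_eq ?_
    congr 1
    rw [← Real.rpow_intCast, ← Real.rpow_natCast, ← Real.rpow_mul (by norm_num),
      ← Real.rpow_mul (by norm_num)]
    congr 1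
    push_cast
    ring
  · refine ((hgeom (α - 2) (by linarith)).mul_left (4 * 2 ^ β * 2 ^ d)).of_nonneg_of_le
      (fun n => hnn (-n)) fun n => ?_
    have h := hsmall (2 ^ (-(n : ℤ))) (by positivity)
      (by rw [zpow_neg, zpow_natCast]; exact inv_le_one_of_one_le₀ (one_le_pow₀ (by norm_num)))
    refine h.trans_eq ?_
    congr 1
    rw [← Real.rpow_intCast, ← Real.rpow_natCast, ← Real.rpow_mul (by norm_num),
      ← Real.rpow_mul (by norm_num)]
    congr 1
    push_cast
    ring

theorem dominatingKernel_le_shellWeight {d : ℕ} {D : Set (EuclideanSpace ℝ (Fin d))} {α β : ℝ}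
    (hα0 : 0 < α) (hβ0 : 0 ≤ β) {x y : EuclideanSpace ℝ (Fin d)} {t : ℝ} (ht : 0 < t)
    (h1 : t ≤ dist x y) (h2 : dist x y < 2 * t) :
    dominatingKernel D α β x y ≤ shellWeight d α β t *
      ((1 + 1 / deltaD D x) ^ β * (1 + 2 * t / deltaD D y) ^ β) := by
  have hx := deltaD_nonneg D x
  have hy := deltaD_nonneg D y
  have hr : 0 < dist x y := ht.trans_le h1
  have hd0 : -((d : ℝ) + α) ≤ 0 := by
    have : (0 : ℝ) ≤ d := Nat.cast_nonneg d
    linarith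
  have hfac : 1 + dist x y / deltaD D x ≤ max 1 (2 * t) * (1 + 1 / deltaD D x) := by
    have h3 : dist x y ≤ max 1 (2 * t) := h2.le.trans (le_max_right _ _)
    have h4 : dist x y / deltaD D x ≤ max 1 (2 * t) * (1 / deltaD D x) := by
      rw [mul_one_div]
      gcongr
    linarith [le_max_left 1 (2 * t)]
  unfold dominatingKernel shellWeight
  calc min 1 (dist x y ^ 2) * dist x y ^ (-((d : ℝ) + α)) *
        ((1 + dist x y / deltaD D x) ^ β * (1 + dist x y / deltaD D y) ^ β)
      ≤ min 1 ((2 * t) ^ 2) * t ^ (-((d : ℝ) + α)) *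
        ((max 1 (2 * t) * (1 + 1 / deltaD D x)) ^ β * (1 + 2 * t / deltaD D y) ^ β) := by
        have := Real.rpow_le_rpow_of_nonpos ht h1 hd0
        gcongr ?_ * ?_ * (?_ ^ β * ?_ ^ β)
        · gcongr
        · gcongr
    _ = _ := by
        rw [Real.mul_rpow (by positivity) (by positivity)]
        ring

theorem Aikawa.exists_lintegral_dominatingKernel_le {d : ℕ}
    {D : Set (EuclideanSpace ℝ (Fin d))} {q α β : ℝ}
    (h : Aikawa D q) (hfr : (frontier D).Nonempty) (hα2 : α < 2) (hβ0 : 0 ≤ β) (hβα : β < α)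
    (hβq : β < q) (hqd : q ≤ d) :
    ∃ M : ℝ≥0∞, M ≠ ⊤ ∧ ∀ x : EuclideanSpace ℝ (Fin d),
      ∫⁻ y, ENNReal.ofReal (dominatingKernel D α β x y) ≤
        M * ENNReal.ofReal ((1 + 1 / deltaD D x) ^ β) := by
  obtain ⟨M, hM, hMb⟩ := h.exists_lintegral_le hfr hβ0 hβq hqd
  have hsum := summable_shellWeight (d := d) hα2 hβ0 hβα
  refine ⟨M * ∑' k : ℤ, ENNReal.ofReal (shellWeight d α β (2 ^ k) * (2 * 2 ^ k) ^ d),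
    ENNReal.mul_ne_top hM hsum.tsum_ofReal_ne_top, fun x => ?_⟩
  set E : ℝ := (1 + 1 / deltaD D x) ^ β with hE
  have hx := deltaD_nonneg D x
  have hE0 : 0 ≤ E := by positivity
  have hw : ∀ k : ℤ, 0 ≤ shellWeight d α β (2 ^ k) := fun k =>
    shellWeight_nonneg d α β (by positivity)
  have hpt : ∀ y, ENNReal.ofReal (dominatingKernel D α β x y) ≤
      ∑' k : ℤ, (ball x (2 * 2 ^ k)).indicator (fun y =>
        ENNReal.ofReal (shellWeight d α β (2 ^ k) * E) *
          ENNReal.ofReal ((1 + 2 * 2 ^ k / deltaD D y) ^ β)) y := by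
    intro y
    rcases (dist_nonneg (x := x) (y := y)).eq_or_lt with h0 | hpos
    · simp [dominatingKernel, ← h0]
    obtain ⟨k, hk1, hk2⟩ := _root_.exists_mem_Ico_zpow (y := 2) hpos (by norm_num)
    rw [zpow_add_one₀ (by norm_num), mul_comm] at hk2
    refine le_trans ?_ (ENNReal.le_tsum k)
    rw [indicator_of_mem (by rwa [mem_ball, dist_comm]),
      ← ENNReal.ofReal_mul (mul_nonneg (hw k) hE0)]
    refine ENNReal.ofReal_le_ofReal
      ((dominatingKernel_le_shellWeight (hβ0.trans_lt hβα) hβ0 (by positivity) hk1 hk2).trans_eq ?_)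
    rw [hE]
    ring
  have hmeas : ∀ k : ℤ, Measurable fun y =>
      ENNReal.ofReal ((1 + 2 * 2 ^ k / deltaD D y) ^ β) := fun k =>
    ((measurable_const.add (measurable_const.div (measurable_deltaD D))).pow_const β).ennreal_ofReal
  calc ∫⁻ y, ENNReal.ofReal (dominatingKernel D α β x y)
      ≤ ∑' k : ℤ, ENNReal.ofReal (shellWeight d α β (2 ^ k) * E) *
          ∫⁻ y in ball x (2 * 2 ^ k), ENNReal.ofReal ((1 + 2 * 2 ^ k / deltaD D y) ^ β) := by
        refine (lintegral_mono hpt).trans_eq ?_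
        rw [lintegral_tsum fun k =>
          (((hmeas k).const_mul _).indicator measurableSet_ball).aemeasurable]
        congr 1
        ext k
        rw [lintegral_indicator measurableSet_ball, lintegral_const_mul _ (hmeas k)]
    _ ≤ ∑' k : ℤ, M * ENNReal.ofReal E *
          ENNReal.ofReal (shellWeight d α β (2 ^ k) * (2 * 2 ^ k) ^ d) := by
        refine ENNReal.tsum_le_tsum fun k => ?_
        calc _ ≤ ENNReal.ofReal (shellWeight d α β (2 ^ k) * E) *
              (M * ENNReal.ofReal ((2 * 2 ^ k) ^ d)) := by
              gcongr
              exact hMb x _ (by positivity)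
          _ = _ := by
              rw [ENNReal.ofReal_mul (hw k), ENNReal.ofReal_mul (hw k)]
              ring
    _ = _ := by
        rw [ENNReal.tsum_mul_left]
        ring

theorem exists_sq_sub_le {d : ℕ} {D K : Set (EuclideanSpace ℝ (Fin d))}
    {u : EuclideanSpace ℝ (Fin d) → ℝ} {L : NNReal} (hL : LipschitzOnWith L u (closure D))
    (hK : IsCompact K) (huK : ∀ x ∈ closure D, x ∉ K → u x = 0) :
    ∃ B : ℝ, 0 ≤ B ∧ ∀ x ∈ D, ∀ y ∈ D, (u x - u y) ^ 2 ≤ B * min 1 (dist x y ^ 2) := by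
  obtain ⟨b, hb⟩ := (hK.inter_right isClosed_closure).exists_bound_of_continuousOn
    (hL.continuousOn.mono inter_subset_right)
  have hbd : ∀ x ∈ D, |u x| ≤ max b 0 := by
    intro x hx
    by_cases hxK : x ∈ K
    · exact (hb x ⟨hxK, subset_closure hx⟩).trans (le_max_left _ _)
    · rw [huK x (subset_closure hx) hxK]
      simp
  refine ⟨(2 * max b 0) ^ 2 + (L : ℝ) ^ 2, by positivity, fun x hx y hy => ?_⟩
  have h1 : (u x - u y) ^ 2 ≤ (2 * max b 0) ^ 2 := by
    refine sq_le_sq' ?_ ?_ <;>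
      linarith [(abs_le.1 (hbd x hx)).1, (abs_le.1 (hbd x hx)).2, (abs_le.1 (hbd y hy)).1,
        (abs_le.1 (hbd y hy)).2]
  have h2 : (u x - u y) ^ 2 ≤ (L : ℝ) ^ 2 * dist x y ^ 2 := by
    have := hL.dist_le_mul x (subset_closure hx) y (subset_closure hy)
    rw [Real.dist_eq] at this
    rw [← mul_pow, ← sq_abs]
    gcongr
  rcases min_cases 1 (dist x y ^ 2) with ⟨h, -⟩ | ⟨h, -⟩ <;> rw [h] <;>
    nlinarith [sq_nonneg (2 * max b 0), sq_nonneg (L : ℝ), sq_nonneg (dist x y),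
      mul_nonneg (sq_nonneg (2 * max b 0)) (sq_nonneg (dist x y))]

theorem Aikawa.lintegral_indicator_dominatingKernel_lt_top {d : ℕ}
    {D : Set (EuclideanSpace ℝ (Fin d))} {q α β : ℝ}
    (h : Aikawa D q) (hfr : (frontier D).Nonempty) (hα2 : α < 2) (hβ0 : 0 ≤ β) (hβα : β < α)
    (hβq : β < q) (hqd : q ≤ d) {R : ℝ} (hR : 1 ≤ R) :
    ∫⁻ x, ∫⁻ y, (ball (0 : EuclideanSpace ℝ (Fin d)) R).indicator 1 x *
      ENNReal.ofReal (dominatingKernel D α β x y) < ⊤ := by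
  obtain ⟨M, hM, hMb⟩ := h.exists_lintegral_le hfr hβ0 hβq hqd
  obtain ⟨M', hM', hMb'⟩ := h.exists_lintegral_dominatingKernel_le hfr hα2 hβ0 hβα hβq hqd
  have hm : ∀ x, Measurable fun y => ENNReal.ofReal (dominatingKernel D α β x y) := fun x =>
    ((measurable_dominatingKernel D α β).comp measurable_prodMk_left).ennreal_ofReal
  calc _ = ∫⁻ x, (ball (0 : EuclideanSpace ℝ (Fin d)) R).indicator
          (fun x => ∫⁻ y, ENNReal.ofReal (dominatingKernel D α β x y)) x := by
        refine lintegral_congr fun x => ?_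
        rw [lintegral_const_mul _ (hm x)]
        by_cases hx : x ∈ ball (0 : EuclideanSpace ℝ (Fin d)) R <;> simp [hx]
    _ = ∫⁻ x in ball 0 R, ∫⁻ y, ENNReal.ofReal (dominatingKernel D α β x y) :=
        lintegral_indicator measurableSet_ball _
    _ ≤ ∫⁻ x in ball 0 R, M' * ENNReal.ofReal ((1 + R / deltaD D x) ^ β) := by
        refine lintegral_mono fun x => (hMb' x).trans ?_
        have := deltaD_nonneg D x
        gcongr
    _ = M' * ∫⁻ x in ball 0 R, ENNReal.ofReal ((1 + R / deltaD D x) ^ β) :=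
        lintegral_const_mul' _ _ hM'
    _ ≤ M' * (M * ENNReal.ofReal (R ^ d)) := by
        gcongr
        exact hMb 0 R (by linarith)
    _ < ⊤ := ENNReal.mul_lt_top hM'.lt_top (ENNReal.mul_lt_top hM.lt_top ENNReal.ofReal_lt_top)

theorem stmt10 {d : ℕ} (hd : 1 ≤ d) (D : Set (EuclideanSpace ℝ (Fin d)))
    (hDopen : IsOpen D) (hDne : D.Nonempty) (hfr : (frontier D).Nonempty)
    (Φ : ℝ → ℝ) (β₁ C_Φ : ℝ) (hβ₁ : 0 ≤ β₁) (hC_Φ : 1 ≤ C_Φ)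
    (hΦ0 : Φ 0 = 1) (hΦ1 : ∀ r : ℝ, 0 ≤ r → 1 ≤ Φ r)
    (hΦmono : MonotoneOn Φ (Set.Ici 0)) (hΦcont : ContinuousOn Φ (Set.Ici 0))
    (hΦscale : ∀ s r : ℝ, 0 < s → s ≤ r → Φ r ≤ C_Φ * (r / s) ^ β₁ * Φ s)
    (α : ℝ) (hα0 : 0 < α) (hα2 : α < 2) (A₀ : ℝ≥0∞) (hA₀ : 0 < A₀)
    (J : EuclideanSpace ℝ (Fin d) → EuclideanSpace ℝ (Fin d) → ℝ)
    (C₁ : ℝ) (hC₁ : 1 < C₁)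
    (hJnn : ∀ x y, 0 ≤ J x y)
    (hJmeas : Measurable (Function.uncurry J))
    (hJsym : ∀ x ∈ D, ∀ y ∈ D, J x y = J y x)
    (hJbound : ∀ x ∈ D, ∀ y ∈ D, x ≠ y →
      C₁⁻¹ * (dist x y ^ (-((d : ℝ) + α)) *
          Φ ((truncMin A₀ (dist x y)) ^ 2 /
            (truncMin A₀ (deltaD D x) * truncMin A₀ (deltaD D y)))) ≤ J x y ∧
      J x y ≤ C₁ * (dist x y ^ (-((d : ℝ) + α)) *
          Φ ((truncMin A₀ (dist x y)) ^ 2 /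
            (truncMin A₀ (deltaD D x) * truncMin A₀ (deltaD D y)))))
    (hβα : β₁ < α) (q' : ℝ) (hβq' : β₁ < q') (hq'd : q' ≤ (d : ℝ))
    (hAik : Aikawa D q')
    (u : EuclideanSpace ℝ (Fin d) → ℝ)
    (hLip : ∃ L : NNReal, LipschitzOnWith L u (closure D))
    (hsupp : ∃ K : Set (EuclideanSpace ℝ (Fin d)), IsCompact K ∧
      ∀ x ∈ closure D, x ∉ K → u x = 0) :
    (∫⁻ p in D ×ˢ D, ENNReal.ofReal ((u p.1 - u p.2) ^ 2 * J p.1 p.2)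
        ∂(MeasureTheory.volume.prod MeasureTheory.volume)) < ⊤ := by
  obtain ⟨L, hL⟩ := hLip
  obtain ⟨K, hK, huK⟩ := hsupp
  obtain ⟨B, hB0, hB⟩ := exists_sq_sub_le hL hK huK
  obtain ⟨R, hR1, hKR⟩ : ∃ R : ℝ, 1 ≤ R ∧ K ⊆ ball 0 R := by
    obtain ⟨R, hR⟩ := hK.isBounded.subset_ball 0
    exact ⟨max 1 R, le_max_left _ _, hR.trans (ball_subset_ball (le_max_right _ _))⟩
  have hΦ10 : 0 ≤ Φ 1 := zero_le_one.trans (hΦ1 1 zero_le_one)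
  set c : ℝ := B * (C₁ * (C_Φ * Φ 1)) with hc
  have hc0 : 0 ≤ c := by positivity
  let ind : EuclideanSpace ℝ (Fin d) → ℝ≥0∞ := (ball 0 R).indicator 1
  let k : EuclideanSpace ℝ (Fin d) → EuclideanSpace ℝ (Fin d) → ℝ≥0∞ := fun x y =>
    ENNReal.ofReal (dominatingKernel D α β₁ x y)
  have hJ : ∀ x ∈ D, ∀ y ∈ D, (u x - u y) ^ 2 * J x y ≤ c * dominatingKernel D α β₁ x y := by
    intro x hx y hy
    rcases eq_or_ne x y with rfl | hxy
    · simp [dominatingKernel]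
    have hdx := deltaD_pos hDopen hfr hx
    have hdy := deltaD_pos hDopen hfr hy
    have hr : 0 ≤ dist x y := dist_nonneg
    obtain ⟨hx1, hx2⟩ := truncMin_div_le hA₀ hr hdx
    obtain ⟨hy1, hy2⟩ := truncMin_div_le hA₀ hr hdy
    have hΦ := scaling_le_rpow_mul_rpow hΦmono hΦscale hx1 hy1 hx2 hy2
      (le_add_of_nonneg_right (by positivity)) (le_add_of_nonneg_right (by positivity))
    calc (u x - u y) ^ 2 * J x y
        ≤ B * min 1 (dist x y ^ 2) * (C₁ * (dist x y ^ (-((d : ℝ) + α)) *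
          (C_Φ * Φ 1 * ((1 + dist x y / deltaD D x) ^ β₁ *
            (1 + dist x y / deltaD D y) ^ β₁)))) := by
          refine mul_le_mul (hB x hx y hy) ((hJbound x hx y hy hxy).2.trans ?_) (hJnn x y)
            (by positivity)
          gcongr
      _ = _ := by
          rw [hc, dominatingKernel]
          ring
  have hpt : ∀ p ∈ D ×ˢ D, ENNReal.ofReal ((u p.1 - u p.2) ^ 2 * J p.1 p.2) ≤
      ENNReal.ofReal c * (ind p.1 * k p.1 p.2 + ind p.2 * k p.1 p.2) := by
    rintro ⟨x, y⟩ ⟨hx, hy⟩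
    have hle : ENNReal.ofReal ((u x - u y) ^ 2 * J x y) ≤ ENNReal.ofReal c * k x y := by
      rw [← ENNReal.ofReal_mul hc0]
      exact ENNReal.ofReal_le_ofReal (hJ x hx y hy)
    by_cases hxR : x ∈ ball 0 R
    · refine hle.trans ?_
      gcongr
      exact le_add_right (by simp [ind, hxR])
    by_cases hyR : y ∈ ball 0 R
    · refine hle.trans ?_
      gcongr
      exact le_add_left (by simp [ind, hyR])
    · simp [huK x (subset_closure hx) fun h => hxR (hKR h),
        huK y (subset_closure hy) fun h => hyR (hKR h)]
  have hk : Measurable fun p : EuclideanSpace ℝ (Fin d) × EuclideanSpace ℝ (Fin d) => k p.1 p.2 :=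
    (measurable_dominatingKernel D α β₁).ennreal_ofReal
  have hind : Measurable ind := measurable_one.indicator measurableSet_ball
  have hfin := hAik.lintegral_indicator_dominatingKernel_lt_top hfr hα2 hβ₁ hβα hβq' hq'd hR1
  have hm1 : Measurable fun p : EuclideanSpace ℝ (Fin d) × EuclideanSpace ℝ (Fin d) =>
    ind p.1 * k p.1 p.2 := (hind.comp measurable_fst).mul hk
  have hm2 : Measurable fun p : EuclideanSpace ℝ (Fin d) × EuclideanSpace ℝ (Fin d) =>
    ind p.2 * k p.1 p.2 := (hind.comp measurable_snd).mul hk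
  refine (setLIntegral_mono' (hDopen.measurableSet.prod hDopen.measurableSet) hpt).trans_lt ?_
  refine (setLIntegral_le_lintegral _ _).trans_lt ?_
  rw [lintegral_const_mul' _ _ ENNReal.ofReal_ne_top, lintegral_add_left hm1,
    lintegral_prod _ hm1.aemeasurable, lintegral_prod_symm _ hm2.aemeasurable]
  refine ENNReal.mul_lt_top ENNReal.ofReal_lt_top (ENNReal.add_lt_top.2 ⟨hfin, ?_⟩)
  simpa only [k, dominatingKernel_comm D α β₁] using hfin
end

section
/- Assume α ∈ (0,2). Let λ ∈ [0,d) be such that ∂D satisfies the covering condition with exponent λ, let q ∈ (0, min(d−λ, α)), and suppose that ∂D satisfies the Aikawa condition with exponent q' for some q' ∈ (q, d]. Then there exists C > 0 such that for every x ∈ closure(D), every r ∈ (0, R₀) and every bounded Borel function u : closure(D) → ℝ with compact support, r^q ∫_{B_D(x,r)} u(y)² δ_D(y)^{−q} dy ≤ C ( r^α ∫_{B_D(x,2r) × B_D(x,2r)} (u(z) − u(y))² |z−y|^{−d−α} dz dy + ∫_{B_D(x,2r)} u(y)² dy ). -/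
open MeasureTheory Metric Set ENNReal Filter

def CoveringCond {d : ℕ} (D : Set (EuclideanSpace ℝ (Fin d))) (lam : ℝ) : Prop :=
  ∃ C_A : ℝ, 1 ≤ C_A ∧ ∀ Q ∈ frontier D, ∀ a b : ℝ, 0 < a → a ≤ b →
    ∃ F : Finset (EuclideanSpace ℝ (Fin d)), (↑F : Set (EuclideanSpace ℝ (Fin d))) ⊆ frontier D ∧
      (F.card : ℝ) ≤ C_A * (b / a) ^ lam ∧
      Metric.ball Q b ∩ frontier D ⊆ ⋃ p ∈ F, Metric.ball p a

/-- Points of a ball centred on the boundary that lie close to the boundary have small volume. -/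
lemma CoveringCond.volume_near_frontier_le {d : ℕ} {D : Set (EuclideanSpace ℝ (Fin d))}
    {lam : ℝ} (hCov : CoveringCond D lam) :
    ∃ K : ℝ, 0 < K ∧ ∀ Q ∈ frontier D, ∀ t b : ℝ, 0 < t → t ≤ b →
      volume {y : EuclideanSpace ℝ (Fin d) | y ∈ ball Q b ∧ infDist y (frontier D) < t} ≤
        ENNReal.ofReal (K * (b / t) ^ lam * t ^ d) *
          volume (ball (0 : EuclideanSpace ℝ (Fin d)) 1) := by
  obtain ⟨CA, hCA, hcov⟩ := hCov
  refine ⟨CA * 2 ^ lam * 2 ^ d, by positivity, fun Q hQ t b ht htb => ?_⟩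
  obtain ⟨F, -, hcard, hF⟩ := hcov Q hQ t (2 * b) ht (by linarith)
  have hsub : {y : EuclideanSpace ℝ (Fin d) | y ∈ ball Q b ∧ infDist y (frontier D) < t} ⊆
      ⋃ p ∈ F, ball p (2 * t) := by
    rintro y ⟨hyQ, hyt⟩
    obtain ⟨P, hP, hyP⟩ := (infDist_lt_iff ⟨Q, hQ⟩).1 hyt
    have hPQ : P ∈ ball Q (2 * b) := by
      rw [mem_ball] at hyQ ⊢
      linarith [dist_triangle_left P Q y]
    obtain ⟨p, hp, hPp⟩ := mem_iUnion₂.1 (hF ⟨hPQ, hP⟩)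
    refine mem_iUnion₂.2 ⟨p, hp, ?_⟩
    rw [mem_ball] at hPp ⊢
    linarith [dist_triangle y P p]
  calc _ ≤ volume (⋃ p ∈ F, ball p (2 * t)) := measure_mono hsub
    _ ≤ ∑ p ∈ F, volume (ball p (2 * t)) := measure_biUnion_finset_le _ _
    _ = ENNReal.ofReal (F.card * (2 * t) ^ d) *
          volume (ball (0 : EuclideanSpace ℝ (Fin d)) 1) := by
        rw [Finset.sum_congr rfl fun p _ => Measure.addHaar_ball_of_pos volume p
          (show 0 < 2 * t by positivity)]
        rw [Finset.sum_const, nsmul_eq_mul, ENNReal.ofReal_mul (by positivity),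
          ENNReal.ofReal_natCast, finrank_euclideanSpace, Fintype.card_fin, mul_assoc]
    _ ≤ _ := by
        refine mul_le_mul_left (ENNReal.ofReal_le_ofReal ?_) _
        calc (F.card : ℝ) * (2 * t) ^ d ≤ (CA * (2 * b / t) ^ lam) * (2 * t) ^ d := by gcongr
          _ = _ := by
            have hb : 0 < b := ht.trans_le htb
            rw [mul_div_assoc, Real.mul_rpow (by norm_num) (by positivity), mul_pow]
            ring

lemma sq_mul_le_of_dist_lt {X : Type*} [MetricSpace X] {u : X → ℝ} {y z : X} {s e : ℝ}
    (he : 0 ≤ e) (hyz : dist y z < s) :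
    (u y - u z) ^ 2 ≤ s ^ e * ((u y - u z) ^ 2 * dist y z ^ (-e)) := by
  rcases eq_or_ne y z with rfl | hne
  · simp
  have hd : 0 < dist y z := dist_pos.2 hne
  have h1 : 1 ≤ s ^ e * dist y z ^ (-e) := by
    rw [Real.rpow_neg hd.le, ← div_eq_mul_inv, one_le_div (by positivity)]
    exact Real.rpow_le_rpow hd.le hyz.le he
  nlinarith [sq_nonneg (u y - u z)]

/-- Averaging over balls of radius `M * t` controls the mass of `u ^ 2` in the boundary layer of
width `t` by the energy and a small multiple of the mass in a wider layer. -/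
lemma CoveringCond.lintegral_layer_le {d : ℕ} {D : Set (EuclideanSpace ℝ (Fin d))}
    (hDopen : IsOpen D) (hfr : (frontier D).Nonempty)
    {κ : ℝ} (hκ0 : 0 < κ) {R₀ : ℝ≥0∞}
    (hfat : ∀ x ∈ closure D, ∀ r : ℝ, 0 < r → ENNReal.ofReal r < R₀ →
      ∃ z ∈ D, Metric.ball z (κ * r) ⊆ D ∩ Metric.ball x r)
    {α : ℝ} (hα0 : 0 < α) {lam : ℝ} (hCov : CoveringCond D lam) :
    ∃ C : ℝ, 0 < C ∧ ∀ u : EuclideanSpace ℝ (Fin d) → ℝ, Measurable u →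
      ∀ (x : EuclideanSpace ℝ (Fin d)) (ρ t M : ℝ), 0 < t → 1 ≤ M →
        ENNReal.ofReal (M * t) < R₀ →
      ∫⁻ y in D ∩ ball x ρ ∩ {y | deltaD D y < t}, ENNReal.ofReal (u y ^ 2) ≤
        ENNReal.ofReal (C * (M * t) ^ α) *
          (∫⁻ p in (D ∩ ball x (ρ + M * t)) ×ˢ (D ∩ ball x (ρ + M * t)),
            ENNReal.ofReal ((u p.1 - u p.2) ^ 2 * dist p.1 p.2 ^ (-((d : ℝ) + α)))
            ∂(volume.prod volume)) +
        ENNReal.ofReal (C * M ^ (lam - d)) *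
          ∫⁻ y in D ∩ ball x (ρ + M * t) ∩ {y | deltaD D y < 2 * M * t},
            ENNReal.ofReal (u y ^ 2) := by
  obtain ⟨K, hK, hvol⟩ := hCov.volume_near_frontier_le
  set W : ℝ≥0∞ := volume (ball (0 : EuclideanSpace ℝ (Fin d)) 1) with hW
  have hW0 : W ≠ 0 := (measure_ball_pos volume _ one_pos).ne'
  have hWtop : W ≠ ∞ := measure_ball_lt_top.ne
  obtain ⟨w, hw, hWw⟩ : ∃ w : ℝ, 0 < w ∧ W = ENNReal.ofReal w :=
    ⟨W.toReal, ENNReal.toReal_pos hW0 hWtop, (ENNReal.ofReal_toReal hWtop).symm⟩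
  have hδ : Measurable (deltaD D) := (continuous_infDist_pt (frontier D)).measurable
  refine ⟨2 / (κ ^ d * w) + 2 * K * 3 ^ lam / κ ^ d, by positivity,
    fun u hu x ρ t M ht hM hMR => ?_⟩
  set s := M * t with hs
  have hs0 : 0 < s := by positivity
  have hts : t ≤ s := by nlinarith
  set A := D ∩ ball x ρ ∩ {y | deltaD D y < t} with hA
  set G := D ∩ ball x (ρ + s) with hG
  have hAm : MeasurableSet A :=
    (hDopen.inter isOpen_ball).measurableSet.inter (measurableSet_lt hδ measurable_const)
  have hGm : MeasurableSet G := (hDopen.inter isOpen_ball).measurableSet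
  have hLm : MeasurableSet {y | deltaD D y < 2 * M * t} := measurableSet_lt hδ measurable_const
  have hAG : A ⊆ G := fun y hy =>
    ⟨hy.1.1, ball_subset_ball (by linarith) hy.1.2⟩
  have hvolA : ∀ z, volume {y | y ∈ A ∧ dist y z < s} ≤
      ENNReal.ofReal (K * 3 ^ lam * M ^ (lam - d) * s ^ d * w) := by
    intro z
    rcases Set.eq_empty_or_nonempty {y | y ∈ A ∧ dist y z < s} with h | ⟨y, hyA, hyz⟩
    · simp [h]
    obtain ⟨Q, hQ, hyQ⟩ := (infDist_lt_iff hfr).1 (show infDist y (frontier D) < t from hyA.2)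
    have hsub : {y | y ∈ A ∧ dist y z < s} ⊆
        {y | y ∈ ball Q (3 * s) ∧ infDist y (frontier D) < t} := by
      rintro v ⟨hwA, hwz⟩
      refine ⟨?_, hwA.2⟩
      rw [mem_ball]
      have h1 := dist_triangle v z Q
      have h2 := dist_triangle_left z Q y
      linarith
    refine (measure_mono hsub).trans ((hvol Q hQ t (3 * s) ht (by linarith)).trans ?_)
    rw [hWw, ← ENNReal.ofReal_mul (by positivity)]
    apply le_of_eq
    congr 2
    have h3 : 3 * s / t = 3 * M := by rw [hs]; field_simp
    rw [h3, Real.mul_rpow (by norm_num) (by positivity), Real.rpow_sub (by positivity),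
      Real.rpow_natCast, hs, mul_pow]
    field_simp
  set V : ℝ := (κ * s) ^ d * w with hV
  have hV0 : 0 < V := by positivity
  have hvolB : ∀ y ∈ A, ENNReal.ofReal V ≤ volume {z | z ∈ G ∧ dist y z < s} := by
    intro y hy
    obtain ⟨z₀, -, hz₀⟩ := hfat y (subset_closure hy.1.1) s hs0 hMR
    have hsub : ball z₀ (κ * s) ⊆ {z | z ∈ G ∧ dist y z < s} := by
      intro z hz
      have hz' := hz₀ hz
      have h1 : dist z y < s := hz'.2
      have h2 : dist y x < ρ := hy.1.2
      refine ⟨⟨hz'.1, ?_⟩, by rwa [dist_comm]⟩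
      rw [mem_ball]
      linarith [dist_triangle z y x]
    refine le_trans (le_of_eq ?_) (measure_mono hsub)
    rw [Measure.addHaar_ball_of_pos volume _ (by positivity : 0 < κ * s),
      finrank_euclideanSpace, Fintype.card_fin, ← hW, hWw, hV,
      ENNReal.ofReal_mul (by positivity)]
  set I : ℝ≥0∞ := ∫⁻ p in G ×ˢ G,
    ENNReal.ofReal ((u p.1 - u p.2) ^ 2 * dist p.1 p.2 ^ (-((d : ℝ) + α)))
      ∂(volume.prod volume) with hI
  set J : ℝ≥0∞ := ∫⁻ y in G ∩ {y | deltaD D y < 2 * M * t}, ENNReal.ofReal (u y ^ 2) with hJ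
  set S : Set (EuclideanSpace ℝ (Fin d) × EuclideanSpace ℝ (Fin d)) :=
    {p | dist p.1 p.2 < s} with hS
  have hSm : MeasurableSet S := measurableSet_lt measurable_dist measurable_const
  set e : ℝ := (d : ℝ) + α with he
  have he0 : 0 ≤ e := by positivity
  set k : EuclideanSpace ℝ (Fin d) → EuclideanSpace ℝ (Fin d) → ℝ≥0∞ := fun y z =>
    ENNReal.ofReal ((u y - u z) ^ 2 * dist y z ^ (-e)) with hk
  have hkm : Measurable (Function.uncurry k) := by
    refine ENNReal.measurable_ofReal.comp (Measurable.mul ?_ ?_)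
    · exact ((hu.comp measurable_fst).sub (hu.comp measurable_snd)).pow_const 2
    · exact measurable_dist.pow_const _
  set g : EuclideanSpace ℝ (Fin d) → EuclideanSpace ℝ (Fin d) → ℝ≥0∞ := fun y z =>
    S.indicator (fun p => ENNReal.ofReal (2 * u p.2 ^ 2)) (y, z) with hg
  have hgm : Measurable (Function.uncurry g) := by
    refine Measurable.indicator ?_ hSm
    exact ENNReal.measurable_ofReal.comp
      (((hu.comp measurable_snd).pow_const 2).const_mul 2)
  have hpoint : ∀ y ∈ A, ENNReal.ofReal V * ENNReal.ofReal (u y ^ 2) ≤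
      ENNReal.ofReal (2 * s ^ e) * (∫⁻ z in G, k y z) + ∫⁻ z in G, g y z := by
    intro y hy
    have hBm : MeasurableSet {z | dist y z < s} :=
      measurableSet_lt (measurable_const.dist measurable_id) measurable_const
    have hkym : Measurable (k y) := hkm.comp measurable_prodMk_left
    calc ENNReal.ofReal V * ENNReal.ofReal (u y ^ 2)
        ≤ volume {z | z ∈ G ∧ dist y z < s} * ENNReal.ofReal (u y ^ 2) := by
          gcongr; exact hvolB y hy
      _ = ∫⁻ z in G, {z | dist y z < s}.indicator (fun _ => ENNReal.ofReal (u y ^ 2)) z := by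
          rw [lintegral_indicator hBm, setLIntegral_const, Measure.restrict_apply hBm, mul_comm]
          congr 2
          ext z
          exact and_comm
      _ ≤ ∫⁻ z in G, (ENNReal.ofReal (2 * s ^ e) * k y z + g y z) := by
          refine lintegral_mono fun z => ?_
          by_cases hz : dist y z < s
          · have h1 : (y, z) ∈ S := hz
            simp only [hg, hk]
            rw [indicator_of_mem (show z ∈ {z | dist y z < s} from hz), indicator_of_mem h1,
              ← ENNReal.ofReal_mul (by positivity), ← ENNReal.ofReal_add (by positivity)
              (by positivity)]
            apply ENNReal.ofReal_le_ofReal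
            have := sq_mul_le_of_dist_lt (u := u) he0 hz
            nlinarith [sq_nonneg (u y - 2 * u z)]
          · rw [indicator_of_notMem (show z ∉ {z | dist y z < s} from hz)]
            exact zero_le
      _ = _ := by
          rw [lintegral_add_left (hkym.const_mul _), lintegral_const_mul _ hkym]
  have hfirst : ∫⁻ y in A, ∫⁻ z in G, k y z ≤ I := by
    calc ∫⁻ y in A, ∫⁻ z in G, k y z ≤ ∫⁻ y in G, ∫⁻ z in G, k y z := lintegral_mono_set hAG
      _ = I := by
        rw [hI, ← Measure.prod_restrict]
        exact (lintegral_prod _ hkm.aemeasurable).symm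
  have hsecond : ∫⁻ y in A, ∫⁻ z in G, g y z ≤
      ENNReal.ofReal (2 * (K * 3 ^ lam * M ^ (lam - d) * s ^ d * w)) * J := by
    rw [lintegral_lintegral_swap hgm.aemeasurable]
    have hz : ∀ z ∈ G, ∫⁻ y in A, g y z ≤ {y | deltaD D y < 2 * M * t}.indicator
        (fun z => ENNReal.ofReal (2 * (K * 3 ^ lam * M ^ (lam - d) * s ^ d * w)) *
          ENNReal.ofReal (u z ^ 2)) z := by
      intro z _
      have hBm : MeasurableSet {y | dist y z < s} :=
        measurableSet_lt (measurable_id.dist measurable_const) measurable_const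
      have heq : ∫⁻ y in A, g y z =
          ENNReal.ofReal (2 * u z ^ 2) * volume {y | y ∈ A ∧ dist y z < s} := by
        have : (fun y => g y z) =
            {y | dist y z < s}.indicator (fun _ => ENNReal.ofReal (2 * u z ^ 2)) := by
          ext y
          simp only [hg, hS, indicator, mem_ofPred_eq]
        rw [this, lintegral_indicator hBm, setLIntegral_const, Measure.restrict_apply hBm]
        congr 2
        ext y
        exact and_comm
      rw [heq]
      by_cases hzt : deltaD D z < 2 * M * t
      · rw [indicator_of_mem (show z ∈ {y | deltaD D y < 2 * M * t} from hzt)]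
        calc _ ≤ ENNReal.ofReal (2 * u z ^ 2) *
              ENNReal.ofReal (K * 3 ^ lam * M ^ (lam - d) * s ^ d * w) := by
              gcongr; exact hvolA z
          _ = _ := by
              rw [← ENNReal.ofReal_mul (by positivity), ← ENNReal.ofReal_mul (by positivity)]
              congr 1
              ring
      · have : {y | y ∈ A ∧ dist y z < s} = ∅ := by
          refine eq_empty_of_forall_notMem fun y hy => hzt ?_
          have h1 : deltaD D y < t := hy.1.2
          have h2 : deltaD D z ≤ deltaD D y + dist z y := infDist_le_infDist_add_dist
          have h3 := hy.2
          rw [dist_comm] at h3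
          linarith
        simp [this]
    refine (setLIntegral_mono' hGm hz).trans (le_of_eq ?_)
    rw [lintegral_indicator hLm, Measure.restrict_restrict hLm, inter_comm,
      lintegral_const_mul _ (hu.pow_const 2).ennreal_ofReal]
  have hmain : ENNReal.ofReal V * ∫⁻ y in A, ENNReal.ofReal (u y ^ 2) ≤
      ENNReal.ofReal (2 * s ^ e) * I +
        ENNReal.ofReal (2 * (K * 3 ^ lam * M ^ (lam - d) * s ^ d * w)) * J := by
    calc ENNReal.ofReal V * ∫⁻ y in A, ENNReal.ofReal (u y ^ 2)
        = ∫⁻ y in A, ENNReal.ofReal V * ENNReal.ofReal (u y ^ 2) :=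
          (lintegral_const_mul _ (hu.pow_const 2).ennreal_ofReal).symm
      _ ≤ ∫⁻ y in A, (ENNReal.ofReal (2 * s ^ e) * (∫⁻ z in G, k y z) + ∫⁻ z in G, g y z) :=
          setLIntegral_mono' hAm hpoint
      _ = ENNReal.ofReal (2 * s ^ e) * (∫⁻ y in A, ∫⁻ z in G, k y z) +
            ∫⁻ y in A, ∫⁻ z in G, g y z := by
          have hkm' : Measurable fun y => ∫⁻ z in G, k y z := hkm.lintegral_prod_right'
          rw [lintegral_add_left (hkm'.const_mul _), lintegral_const_mul _ hkm']
      _ ≤ _ := by gcongr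
  calc ∫⁻ y in A, ENNReal.ofReal (u y ^ 2)
      = ENNReal.ofReal V⁻¹ * (ENNReal.ofReal V * ∫⁻ y in A, ENNReal.ofReal (u y ^ 2)) := by
        rw [← mul_assoc, ← ENNReal.ofReal_mul (by positivity), inv_mul_cancel₀ hV0.ne',
          ENNReal.ofReal_one, one_mul]
    _ ≤ ENNReal.ofReal V⁻¹ * (ENNReal.ofReal (2 * s ^ e) * I +
        ENNReal.ofReal (2 * (K * 3 ^ lam * M ^ (lam - d) * s ^ d * w)) * J) := by gcongr
    _ = ENNReal.ofReal (V⁻¹ * (2 * s ^ e)) * I +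
        ENNReal.ofReal (V⁻¹ * (2 * (K * 3 ^ lam * M ^ (lam - d) * s ^ d * w))) * J := by
        rw [mul_add, ← mul_assoc, ← mul_assoc, ← ENNReal.ofReal_mul (by positivity),
          ← ENNReal.ofReal_mul (by positivity)]
    _ ≤ _ := by
        refine add_le_add (mul_le_mul_left (ENNReal.ofReal_le_ofReal ?_) _)
          (mul_le_mul_left (ENNReal.ofReal_le_ofReal ?_) _)
        · have : V⁻¹ * (2 * s ^ e) = 2 / (κ ^ d * w) * s ^ α := by
            rw [he, Real.rpow_add hs0, Real.rpow_natCast, hV, mul_pow]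
            field_simp
          rw [this]
          gcongr
          exact le_add_of_nonneg_right (by positivity)
        · have : V⁻¹ * (2 * (K * 3 ^ lam * M ^ (lam - d) * s ^ d * w)) =
              2 * K * 3 ^ lam / κ ^ d * M ^ (lam - d) := by
            rw [hV, mul_pow]
            field_simp
          rw [this]
          gcongr
          exact le_add_of_nonneg_left (by positivity)

/-- A sequence that is halved at each step up to a summable error is summable. -/
lemma ENNReal.tsum_le_of_le_half_mul_add {β ε : ℕ → ℝ≥0∞}
    (h : ∀ k, β (k + 1) ≤ ENNReal.ofReal (1 / 2) * β k + ε k) :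
    ∑' k, β k ≤ 2 * (β 0 + ∑' k, ε k) := by
  have hhalf : ENNReal.ofReal (1 / 2) * 2 = 1 := by
    rw [← ENNReal.ofReal_ofNat 2, ← ENNReal.ofReal_mul (by norm_num)]
    norm_num
  refine ENNReal.tsum_le_of_sum_range_le fun n => ?_
  induction n with
  | zero => simp
  | succ n ih =>
    calc ∑ k ∈ Finset.range (n + 1), β k
        = ∑ k ∈ Finset.range n, β (k + 1) + β 0 := Finset.sum_range_succ' _ _
      _ ≤ ∑ k ∈ Finset.range n, (ENNReal.ofReal (1 / 2) * β k + ε k) + β 0 := by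
          gcongr with k; exact h k
      _ = ENNReal.ofReal (1 / 2) * ∑ k ∈ Finset.range n, β k +
            (β 0 + ∑ k ∈ Finset.range n, ε k) := by
          rw [Finset.sum_add_distrib, Finset.mul_sum]; ring
      _ ≤ ENNReal.ofReal (1 / 2) * (2 * (β 0 + ∑' k, ε k)) + (β 0 + ∑' k, ε k) := by
          gcongr
          exact ENNReal.sum_le_tsum _
      _ = _ := by rw [← mul_assoc, hhalf, one_mul, two_mul]

/-- Dyadic-type decomposition of a negative power. -/
lemma ofReal_rpow_neg_le_tsum {a t L q : ℝ} (ha : 0 < a) (ht : 0 < t) (hL : 1 < L)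
    (hq : 0 < q) :
    ENNReal.ofReal (a ^ (-q)) ≤ ENNReal.ofReal (t ^ (-q)) +
      ∑' k : ℕ, (if a < t / L ^ k then ENNReal.ofReal ((t / L ^ (k + 1)) ^ (-q)) else 0) := by
  have hL0 : 0 < L := by linarith
  rcases le_or_gt t a with hta | hat
  · refine le_add_right (ENNReal.ofReal_le_ofReal ?_)
    exact Real.rpow_le_rpow_of_nonpos ht hta (by linarith)
  have hex : ∃ n : ℕ, t / L ^ n ≤ a := by
    obtain ⟨n, hn⟩ := pow_unbounded_of_one_lt (t / a) hL
    exact ⟨n, (div_lt_comm₀ ha (by positivity)).1 hn |>.le⟩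
  obtain ⟨n, hn, hmin⟩ : ∃ n : ℕ, t / L ^ n ≤ a ∧ ∀ m < n, a < t / L ^ m := by
    classical
    exact ⟨Nat.find hex, Nat.find_spec hex, fun m hm => not_le.1 (Nat.find_min hex hm)⟩
  obtain ⟨k, rfl⟩ : ∃ k, n = k + 1 := Nat.exists_eq_succ_of_ne_zero fun h => by
    rw [h, pow_zero, div_one] at hn
    linarith
  refine le_add_left (le_trans ?_ (ENNReal.le_tsum k))
  rw [if_pos (hmin k k.lt_succ_self)]
  exact ENNReal.ofReal_le_ofReal
    (Real.rpow_le_rpow_of_nonpos (by positivity) hn (by linarith))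

theorem stmt11 {d : ℕ} (hd : 1 ≤ d) (D : Set (EuclideanSpace ℝ (Fin d)))
    (hDopen : IsOpen D) (hDne : D.Nonempty) (hfr : (frontier D).Nonempty)
    (κ : ℝ) (hκ0 : 0 < κ) (hκ1 : κ < 1) (R₀ : ℝ≥0∞) (hR₀0 : 0 < R₀)
    (hR₀diam : R₀ ≤ EMetric.diam D)
    (hfat : ∀ x ∈ closure D, ∀ r : ℝ, 0 < r → ENNReal.ofReal r < R₀ →
      ∃ z ∈ D, Metric.ball z (κ * r) ⊆ D ∩ Metric.ball x r)
    (α : ℝ) (hα0 : 0 < α) (hα2 : α < 2)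
    (lam : ℝ) (hlam0 : 0 ≤ lam) (hlamd : lam < (d : ℝ)) (hCov : CoveringCond D lam)
    (q : ℝ) (hq0 : 0 < q) (hqlam : q < (d : ℝ) - lam) (hqα : q < α)
    (q' : ℝ) (hqq' : q < q') (hq'd : q' ≤ (d : ℝ)) (hAik : Aikawa D q') :
    ∃ C : ℝ, 0 < C ∧ ∀ x ∈ closure D, ∀ r : ℝ, 0 < r → ENNReal.ofReal r < R₀ →
      ∀ u : EuclideanSpace ℝ (Fin d) → ℝ, Measurable u →
        (∃ M : ℝ, ∀ y, |u y| ≤ M) →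
        (∃ K : Set (EuclideanSpace ℝ (Fin d)), IsCompact K ∧
          ∀ y ∈ closure D, y ∉ K → u y = 0) →
      ENNReal.ofReal (r ^ q) *
          (∫⁻ y in D ∩ Metric.ball x r,
            ENNReal.ofReal (u y ^ 2 * deltaD D y ^ (-q))) ≤
        ENNReal.ofReal C *
          (ENNReal.ofReal (r ^ α) *
            (∫⁻ p in (D ∩ Metric.ball x (2 * r)) ×ˢ (D ∩ Metric.ball x (2 * r)),
              ENNReal.ofReal ((u p.1 - u p.2) ^ 2 * dist p.1 p.2 ^ (-((d : ℝ) + α)))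
              ∂(MeasureTheory.volume.prod MeasureTheory.volume)) +
          ∫⁻ y in D ∩ Metric.ball x (2 * r), ENNReal.ofReal (u y ^ 2)) := by
  obtain ⟨C₁, hC₁, hstep⟩ := hCov.lintegral_layer_le hDopen hfr hκ0 hfat hα0
  obtain ⟨M, hM1, hM⟩ : ∃ M : ℝ, 1 ≤ M ∧ C₁ * M ^ (lam - d) ≤ 1 / 2 * (2 * M) ^ (-q) := by
    have htend := tendsto_rpow_atTop (show 0 < (d : ℝ) - lam - q by linarith)
    obtain ⟨M, hM, hM1⟩ := ((htend.eventually_ge_atTop (2 * C₁ * 2 ^ q)).and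
      (eventually_ge_atTop 1)).exists
    refine ⟨M, hM1, ?_⟩
    have hM0 : 0 < M := by linarith
    have h1 : M ^ ((d : ℝ) - lam - q) * M ^ (lam - d) = M ^ (-q) := by
      rw [← Real.rpow_add hM0]
      congr 1
      ring
    rw [Real.mul_rpow (by norm_num) hM0.le, ← h1, Real.rpow_neg (by norm_num : (0 : ℝ) ≤ 2)]
    have h2 : 0 < M ^ (lam - d) := by positivity
    have h3 : C₁ ≤ 1 / 2 * ((2 ^ q)⁻¹ * M ^ ((d : ℝ) - lam - q)) := by
      have h4 : 0 < (2 : ℝ) ^ q := by positivity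
      field_simp
      linarith
    nlinarith
  set L := 2 * M with hL
  have hL2 : 2 ≤ L := by linarith
  have hL0 : 0 < L := by linarith
  set g := L ^ (q - α) with hg
  have hg0 : 0 < g := by positivity
  have hg1 : g < 1 := Real.rpow_lt_one_of_one_lt_of_neg (by linarith) (by linarith)
  have hg1' : 0 < 1 - g := by linarith
  refine ⟨2 ^ q + 2 ^ q * L ^ q * 2 + 2 ^ q * L ^ q * 2 * (C₁ * L ^ q * (1 - g)⁻¹),
    by positivity, fun x _ r hr hrR u hu _ _ => ?_⟩
  set I : ℝ≥0∞ := ∫⁻ p in (D ∩ Metric.ball x (2 * r)) ×ˢ (D ∩ Metric.ball x (2 * r)),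
    ENNReal.ofReal ((u p.1 - u p.2) ^ 2 * dist p.1 p.2 ^ (-((d : ℝ) + α)))
    ∂(MeasureTheory.volume.prod MeasureTheory.volume) with hI
  set T : ℝ≥0∞ := ∫⁻ y in D ∩ Metric.ball x (2 * r), ENNReal.ofReal (u y ^ 2) with hT
  set t : ℕ → ℝ := fun k => r / 2 / L ^ k with ht
  have ht0 : ∀ k, 0 < t k := fun k => by positivity
  have htL : ∀ k, L * t (k + 1) = t k := fun k => by
    simp only [ht, pow_succ]
    field_simp
  have htle : ∀ k, t k ≤ r / 2 := fun k =>
    div_le_self (by positivity) (one_le_pow₀ (by linarith))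
  set b : ℕ → ℝ≥0∞ := fun k =>
    ∫⁻ y in D ∩ ball x (r + 2 * t k) ∩ {y | deltaD D y < t k}, ENNReal.ofReal (u y ^ 2) with hb
  set β : ℕ → ℝ≥0∞ := fun k => ENNReal.ofReal ((L ^ k) ^ q) * b k with hβ
  have hrec : ∀ k, β (k + 1) ≤ ENNReal.ofReal (1 / 2) * β k +
      ENNReal.ofReal (C₁ * L ^ q * r ^ α * g ^ k) * I := by
    intro k
    have hMt : M * t (k + 1) = t k / 2 := by rw [← htL k, hL]; ring
    have hthalf : 2 * t (k + 1) ≤ t k := by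
      rw [← htL k]
      exact mul_le_mul_of_nonneg_right hL2 (ht0 _).le
    have hsmall : ENNReal.ofReal (M * t (k + 1)) < R₀ :=
      (ENNReal.ofReal_le_ofReal (by linarith [htle k])).trans_lt hrR
    have h := hstep u hu x (r + 2 * t (k + 1)) (t (k + 1)) M (ht0 _) hM1 hsmall
    rw [← hL, htL k, hMt] at h
    have hb1 : b (k + 1) ≤ ENNReal.ofReal (C₁ * (t k / 2) ^ α) * I +
        ENNReal.ofReal (1 / 2 * L ^ (-q)) * b k := by
      refine h.trans (add_le_add (mul_le_mul_right ?_ _) (mul_le_mul'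
        (ENNReal.ofReal_le_ofReal hM) ?_))
      · have hsub : D ∩ ball x (r + 2 * t (k + 1) + t k / 2) ⊆ D ∩ ball x (2 * r) :=
          inter_subset_inter_right _ (ball_subset_ball (by linarith [htle k]))
        exact lintegral_mono_set (prod_mono hsub hsub)
      · exact lintegral_mono_set (inter_subset_inter_left _
          (inter_subset_inter_right _ (ball_subset_ball (by linarith [ht0 k]))))
    calc β (k + 1) ≤ ENNReal.ofReal ((L ^ (k + 1)) ^ q) *
          (ENNReal.ofReal (C₁ * (t k / 2) ^ α) * I +
            ENNReal.ofReal (1 / 2 * L ^ (-q)) * b k) := by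
          simp only [hβ]; gcongr
      _ = ENNReal.ofReal ((L ^ (k + 1)) ^ q * (1 / 2 * L ^ (-q))) * b k +
          ENNReal.ofReal ((L ^ (k + 1)) ^ q * (C₁ * (t k / 2) ^ α)) * I := by
          rw [mul_add, ← mul_assoc, ← mul_assoc, ← ENNReal.ofReal_mul (by positivity),
            ← ENNReal.ofReal_mul (by positivity), add_comm]
      _ ≤ _ := by
          simp only [hβ]
          rw [← mul_assoc (ENNReal.ofReal (1 / 2)), ← ENNReal.ofReal_mul (by norm_num)]
          refine add_le_add (mul_le_mul_left (ENNReal.ofReal_le_ofReal (le_of_eq ?_)) _)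
            (mul_le_mul_left (ENNReal.ofReal_le_ofReal ?_) _)
          · rw [pow_succ, Real.mul_rpow (by positivity) hL0.le, Real.rpow_neg hL0.le]
            field_simp
          · have h1 : g ^ k = (L ^ k) ^ q * ((L ^ k) ^ α)⁻¹ := by
              rw [hg, ← Real.rpow_natCast, ← Real.rpow_natCast, ← Real.rpow_mul hL0.le,
                ← Real.rpow_mul hL0.le, ← Real.rpow_mul hL0.le, ← Real.rpow_neg hL0.le,
                ← Real.rpow_add hL0]
              congr 1
              ring
            have h2 : (t k / 2) ^ α ≤ r ^ α * ((L ^ k) ^ α)⁻¹ := by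
              rw [← div_eq_mul_inv, ← Real.div_rpow hr.le (by positivity)]
              refine Real.rpow_le_rpow (by linarith [ht0 k]) ?_ hα0.le
              simp only [ht]
              have h3 : 0 < r / L ^ k := by positivity
              calc r / 2 / L ^ k / 2 = (r / L ^ k) / 4 := by ring
                _ ≤ r / L ^ k := by linarith
            rw [h1, pow_succ, Real.mul_rpow (by positivity) hL0.le]
            calc (L ^ k) ^ q * L ^ q * (C₁ * (t k / 2) ^ α)
                ≤ (L ^ k) ^ q * L ^ q * (C₁ * (r ^ α * ((L ^ k) ^ α)⁻¹)) := by gcongr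
              _ = _ := by ring
  have hβ0 : β 0 ≤ T := by
    simp only [hβ, hb, pow_zero, Real.one_rpow, ENNReal.ofReal_one, one_mul]
    refine lintegral_mono_set (inter_subset_left.trans (inter_subset_inter_right _
      (ball_subset_ball (by linarith [htle 0]))))
  have hsum : ∑' k, β k ≤
      2 * (T + ENNReal.ofReal (C₁ * L ^ q * (1 - g)⁻¹) * (ENNReal.ofReal (r ^ α) * I)) := by
    refine (ENNReal.tsum_le_of_le_half_mul_add hrec).trans ?_
    refine mul_le_mul_right (add_le_add hβ0 (le_of_eq ?_)) _
    rw [ENNReal.tsum_mul_right, ← ENNReal.ofReal_tsum_of_nonneg (fun k => by positivity)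
      ((summable_geometric_of_lt_one hg0.le hg1).mul_left _), tsum_mul_left,
      tsum_geometric_of_lt_one hg0.le hg1, ← mul_assoc, ← ENNReal.ofReal_mul (by positivity)]
    congr 2
    ring
  have hδ : Measurable (deltaD D) := (continuous_infDist_pt (frontier D)).measurable
  have hLm : ∀ k, MeasurableSet {y | deltaD D y < t k} := fun k =>
    measurableSet_lt hδ measurable_const
  have hum : Measurable fun y => ENNReal.ofReal (u y ^ 2) := (hu.pow_const 2).ennreal_ofReal
  have hmeas : MeasurableSet (D ∩ ball x r) := (hDopen.inter isOpen_ball).measurableSet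
  have hterm : ∀ k, Measurable fun y => {y | deltaD D y < t k}.indicator
      (fun y => ENNReal.ofReal (t (k + 1) ^ (-q)) * ENNReal.ofReal (u y ^ 2)) y := fun k =>
    (hum.const_mul _).indicator (hLm k)
  have hpoint : ∀ y ∈ D ∩ ball x r, ENNReal.ofReal (u y ^ 2 * deltaD D y ^ (-q)) ≤
      ENNReal.ofReal ((r / 2) ^ (-q)) * ENNReal.ofReal (u y ^ 2) +
        ∑' k, {y | deltaD D y < t k}.indicator
          (fun y => ENNReal.ofReal (t (k + 1) ^ (-q)) * ENNReal.ofReal (u y ^ 2)) y := by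
    intro y hy
    have hδy : 0 < deltaD D y := by
      refine (isClosed_frontier.notMem_iff_infDist_pos hfr).1 fun h => ?_
      rw [hDopen.frontier_eq] at h
      exact h.2 hy.1
    calc ENNReal.ofReal (u y ^ 2 * deltaD D y ^ (-q))
        = ENNReal.ofReal (deltaD D y ^ (-q)) * ENNReal.ofReal (u y ^ 2) := by
          rw [mul_comm, ENNReal.ofReal_mul (by positivity)]
      _ ≤ _ := mul_le_mul_left (ofReal_rpow_neg_le_tsum hδy (by positivity : 0 < r / 2)
          (by linarith : 1 < L) hq0) _
      _ = _ := by
          rw [add_mul, ← ENNReal.tsum_mul_right]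
          congr 1
          refine tsum_congr fun k => ?_
          simp only [indicator, mem_ofPred_eq, ht, ite_mul, zero_mul]
  have hlayer : ∀ k, ENNReal.ofReal (r ^ q) * ∫⁻ y in D ∩ ball x r,
      {y | deltaD D y < t k}.indicator
        (fun y => ENNReal.ofReal (t (k + 1) ^ (-q)) * ENNReal.ofReal (u y ^ 2)) y ≤
      ENNReal.ofReal (2 ^ q * L ^ q) * β k := by
    intro k
    rw [lintegral_indicator (hLm k), Measure.restrict_restrict (hLm k),
      lintegral_const_mul _ hum, ← mul_assoc, ← ENNReal.ofReal_mul (by positivity)]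
    simp only [hβ]
    rw [← mul_assoc, ← ENNReal.ofReal_mul (by positivity)]
    refine mul_le_mul' (le_of_eq (congrArg _ ?_)) (lintegral_mono_set ?_)
    · simp only [ht]
      rw [Real.rpow_neg (by positivity), Real.div_rpow (by positivity) (by positivity),
        Real.div_rpow hr.le (by norm_num), pow_succ, Real.mul_rpow (by positivity) hL0.le]
      field_simp
    · rw [inter_comm]
      exact inter_subset_inter_left _ (inter_subset_inter_right _
        (ball_subset_ball (by linarith [ht0 k])))
  have hbase : ENNReal.ofReal (r ^ q) * (ENNReal.ofReal ((r / 2) ^ (-q)) *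
      ∫⁻ y in D ∩ ball x r, ENNReal.ofReal (u y ^ 2)) ≤ ENNReal.ofReal (2 ^ q) * T := by
    rw [← mul_assoc, ← ENNReal.ofReal_mul (by positivity)]
    refine mul_le_mul' (le_of_eq (congrArg _ ?_)) (lintegral_mono_set
      (inter_subset_inter_right _ (ball_subset_ball (by linarith))))
    rw [Real.rpow_neg (by positivity), Real.div_rpow hr.le (by norm_num)]
    field_simp
  calc ENNReal.ofReal (r ^ q) *
        (∫⁻ y in D ∩ ball x r, ENNReal.ofReal (u y ^ 2 * deltaD D y ^ (-q)))
      ≤ ENNReal.ofReal (r ^ q) * ∫⁻ y in D ∩ ball x r,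
          (ENNReal.ofReal ((r / 2) ^ (-q)) * ENNReal.ofReal (u y ^ 2) +
          ∑' k, {y | deltaD D y < t k}.indicator
            (fun y => ENNReal.ofReal (t (k + 1) ^ (-q)) * ENNReal.ofReal (u y ^ 2)) y) :=
        mul_le_mul_right (setLIntegral_mono' hmeas hpoint) _
    _ = ENNReal.ofReal (r ^ q) * (ENNReal.ofReal ((r / 2) ^ (-q)) *
          ∫⁻ y in D ∩ ball x r, ENNReal.ofReal (u y ^ 2)) +
        ∑' k, ENNReal.ofReal (r ^ q) * ∫⁻ y in D ∩ ball x r,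
          {y | deltaD D y < t k}.indicator
            (fun y => ENNReal.ofReal (t (k + 1) ^ (-q)) * ENNReal.ofReal (u y ^ 2)) y := by
        rw [lintegral_add_left (hum.const_mul _), lintegral_const_mul _ hum,
          lintegral_tsum fun k => (hterm k).aemeasurable, mul_add, ENNReal.tsum_mul_left]
    _ ≤ ENNReal.ofReal (2 ^ q) * T + ∑' k, ENNReal.ofReal (2 ^ q * L ^ q) * β k :=
        add_le_add hbase (ENNReal.tsum_le_tsum hlayer)
    _ ≤ ENNReal.ofReal (2 ^ q) * T + ENNReal.ofReal (2 ^ q * L ^ q) *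
          (2 * (T + ENNReal.ofReal (C₁ * L ^ q * (1 - g)⁻¹) * (ENNReal.ofReal (r ^ α) * I))) := by
        rw [ENNReal.tsum_mul_left]
        gcongr
    _ = ENNReal.ofReal (2 ^ q * L ^ q * 2 * (C₁ * L ^ q * (1 - g)⁻¹)) *
          (ENNReal.ofReal (r ^ α) * I) + ENNReal.ofReal (2 ^ q + 2 ^ q * L ^ q * 2) * T := by
        rw [ENNReal.ofReal_add (by positivity) (by positivity),
          ENNReal.ofReal_mul (p := 2 ^ q * L ^ q * 2) (by positivity),
          ENNReal.ofReal_mul (p := 2 ^ q * L ^ q) (by positivity), ENNReal.ofReal_ofNat]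
        ring
    _ ≤ _ := by
        rw [mul_add]
        refine add_le_add (mul_le_mul_left (ENNReal.ofReal_le_ofReal ?_) _)
          (mul_le_mul_left (ENNReal.ofReal_le_ofReal ?_) _)
        · exact le_add_of_nonneg_left (by positivity)
        · exact le_add_of_nonneg_right (by positivity)
end
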